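/- arXiv:2101.05344 — 9 statements merged into one kernel-verified Lean document; each statement's English description precedes it below -/
import Mathlib

section
/- Let p₂ ≥ 2 and let p₃ ≥ 3 be odd. In the triangle group Δ(2, p₂, p₃), the pair (s₂, s₁s₂s₁⁻¹) is Nielsen equivalent to the standard pair (s₁, s₃²). -/
/-- Relators of the triangle group Δ(p₁,p₂,p₃) on generators s₁,s₂,s₃. -/
def triangleRels (p₁ p₂ p₃ : ℕ) : Set (FreeGroup (Fin 3)) :=
  {FreeGroup.of 0 ^ p₁, FreeGroup.of 1 ^ p₂, FreeGroup.of 2 ^ p₃,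
    FreeGroup.of 0 * FreeGroup.of 1 * FreeGroup.of 2}

/-- The triangle group Δ(p₁,p₂,p₃). -/
abbrev Triangle (p₁ p₂ p₃ : ℕ) := PresentedGroup (triangleRels p₁ p₂ p₃)

/-- The images s₁, s₂, s₃ of the generators in the triangle group
(indexed by `0, 1, 2 : Fin 3`). -/
def triS (p₁ p₂ p₃ : ℕ) (i : Fin 3) : Triangle p₁ p₂ p₃ := PresentedGroup.of i

/-- An elementary Nielsen transformation on pairs of elements of a group. -/
inductive NielsenStep {G : Type*} [Group G] : G × G → G × G → Prop
  | inv₁ (g h : G) : NielsenStep (g, h) (g⁻¹, h)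
  | inv₂ (g h : G) : NielsenStep (g, h) (g, h⁻¹)
  | swap (g h : G) : NielsenStep (g, h) (h, g)
  | mul₁ (g h : G) : NielsenStep (g, h) (g * h, h)
  | mul₂ (g h : G) : NielsenStep (g, h) (g, h * g)

/-- Nielsen equivalence of pairs: the equivalence closure of elementary
Nielsen transformations. -/
def NielsenEquiv {G : Type*} [Group G] : G × G → G × G → Prop :=
  Relation.EqvGen NielsenStep

theorem NielsenEquiv.mul_pow₂ {G : Type*} [Group G] (g h : G) (k : ℕ) :
    NielsenEquiv (g, h) (g, h * g ^ k) := by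
  induction k with
  | zero =>
    rw [pow_zero, mul_one]
    exact .refl _
  | succ k ih =>
    refine ih.trans _ _ _ (.rel _ _ ?_)
    rw [pow_succ, ← mul_assoc]
    exact .mul₂ _ _

/-- The statement for elements of an arbitrary group satisfying the relations of `Δ(2, ∞, 2k+1)`. -/
theorem nielsenEquiv_of_triangle_relations {G : Type*} [Group G] {a b c : G} {k : ℕ}
    (ha : a ^ 2 = 1) (hc : c ^ (2 * k + 1) = 1) (habc : a * b * c = 1) :
    NielsenEquiv (b, a * b * a⁻¹) (a, c ^ 2) := by
  have haa : a * a = 1 := by rw [← sq, ha]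
  have hab : a * b = c⁻¹ := eq_inv_of_mul_eq_one_left habc
  have hb : b⁻¹ = c * a := by
    rw [← inv_inj, inv_inv, mul_inv_rev, ← hab, inv_mul_cancel_left]
  have hconj : (a * b * a⁻¹)⁻¹ = a * c := by rw [hab, mul_inv_rev, inv_inv, inv_inv]
  have hsq : c * a * (a * c) = c ^ 2 := by
    rw [mul_assoc, ← mul_assoc a, haa, one_mul, sq]
  have hpow : a * c * (c ^ 2) ^ k = a := by
    rw [← pow_mul, mul_assoc, ← pow_succ', hc, mul_one]
  have inv_step : NielsenEquiv (b, a * b * a⁻¹) (c * a, a * c) := by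
    rw [← hb, ← hconj]
    exact (Relation.EqvGen.rel _ _ (.inv₁ _ _)).trans _ _ _ (.rel _ _ (.inv₂ _ _))
  have mul_step : NielsenEquiv (c * a, a * c) (c ^ 2, a * c) := by
    rw [← hsq]
    exact .rel _ _ (.mul₁ _ _)
  have pow_step : NielsenEquiv (c ^ 2, a * c) (c ^ 2, a) := by
    have h := NielsenEquiv.mul_pow₂ (c ^ 2) (a * c) k
    rwa [hpow] at h
  exact ((inv_step.trans _ _ _ mul_step).trans _ _ _ pow_step).trans _ _ _
    (.rel _ _ (.swap _ _))

theorem stmt_2 (p₂ p₃ : ℕ) (hp₂ : 2 ≤ p₂) (hp₃ : 3 ≤ p₃) (hodd : Odd p₃)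
    (S : Fin 3 → Triangle 2 p₂ p₃) (hS : S = triS 2 p₂ p₃) :
    NielsenEquiv (S 1, S 0 * S 1 * (S 0)⁻¹) (S 0, S 2 ^ 2) := by
  subst hS
  obtain ⟨k, rfl⟩ := hodd
  have rel {r : FreeGroup (Fin 3)} (hr : r ∈ triangleRels 2 p₂ (2 * k + 1)) :
      PresentedGroup.mk (triangleRels 2 p₂ (2 * k + 1)) r = 1 :=
    PresentedGroup.one_of_mem hr
  exact nielsenEquiv_of_triangle_relations
    (rel (r := FreeGroup.of 0 ^ 2) (by simp [triangleRels]))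
    (rel (r := FreeGroup.of 2 ^ (2 * k + 1)) (by simp [triangleRels]))
    (rel (r := FreeGroup.of 0 * FreeGroup.of 1 * FreeGroup.of 2) (by simp [triangleRels]))
end

section
/- Let p₂ ≥ 2, let p₃ ≥ 3 be odd, and let ν, ν' be integers with gcd(ν, p₂) = gcd(ν', p₂) = 1. Then the pair (s₂^ν, s₁s₂^{ν'}s₁⁻¹) is a generating pair of the triangle group Δ(2, p₂, p₃). -/
/-- A subgroup containing a power `x ^ n` with `n` coprime to a period of `x` contains `x`. -/
theorem mem_of_zpow_mem_of_gcd_eq_one {G : Type*} [Group G] {H : Subgroup G} {x : G}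
    {n : ℤ} {m : ℕ} (hx : x ^ m = 1) (hgcd : Int.gcd n m = 1) (h : x ^ n ∈ H) : x ∈ H := by
  have hbez : n * n.gcdA m + m * n.gcdB m = 1 := by
    rw [← Int.gcd_eq_gcd_ab, hgcd, Nat.cast_one]
  have hpow : x = (x ^ n) ^ n.gcdA m := by
    conv_lhs => rw [← zpow_one x, ← hbez, zpow_add, zpow_mul, zpow_mul, zpow_natCast, hx,
      one_zpow, mul_one]
  rw [hpow]
  exact H.zpow_mem h _

/-- If `a` is an involution and `a * b` has odd period, then a subgroup containing `b` and its
conjugate by `a` contains `a`. -/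
theorem mem_of_conj_mem_of_odd {G : Type*} [Group G] {H : Subgroup G} {a b : G} {n : ℕ}
    (ha : a ^ 2 = 1) (hab : (a * b) ^ n = 1) (hn : Odd n) (hb : b ∈ H)
    (hconj : a * b * a⁻¹ ∈ H) : a ∈ H := by
  have hinv : a⁻¹ = a := inv_eq_of_mul_eq_one_left (by rw [← sq, ha])
  have hsq : (a * b) ^ 2 ∈ H := by
    have : (a * b) ^ 2 = a * b * a⁻¹ * b := by rw [hinv, sq]; group
    rw [this]
    exact H.mul_mem hconj hb
  obtain ⟨k, rfl⟩ := hn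
  have hpow : ((a * b) ^ 2) ^ (k + 1) = a * b := by
    rw [← pow_mul, show 2 * (k + 1) = 2 * k + 1 + 1 by ring, pow_succ, hab, one_mul]
  have : a * b ∈ H := hpow ▸ H.pow_mem hsq (k + 1)
  exact (H.mul_mem_cancel_right hb).1 this

theorem stmt_3 (p₂ p₃ : ℕ) (hp₂ : 2 ≤ p₂) (hp₃ : 3 ≤ p₃) (hodd : Odd p₃)
    (ν ν' : ℤ) (hν : Int.gcd ν p₂ = 1) (hν' : Int.gcd ν' p₂ = 1)
    (S : Fin 3 → Triangle 2 p₂ p₃) (hS : S = triS 2 p₂ p₃) :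
    Subgroup.closure {S 1 ^ ν, S 0 * S 1 ^ ν' * (S 0)⁻¹} =
      (⊤ : Subgroup (Triangle 2 p₂ p₃)) := by
  subst hS
  set a := triS 2 p₂ p₃ 0
  set b := triS 2 p₂ p₃ 1
  set c := triS 2 p₂ p₃ 2
  have ha : a ^ 2 = 1 :=
    PresentedGroup.one_of_mem (rels := triangleRels 2 p₂ p₃) (x := FreeGroup.of 0 ^ 2)
      (by simp [triangleRels])
  have hb : b ^ p₂ = 1 :=
    PresentedGroup.one_of_mem (rels := triangleRels 2 p₂ p₃) (x := FreeGroup.of 1 ^ p₂)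
      (by simp [triangleRels])
  have hc : c ^ p₃ = 1 :=
    PresentedGroup.one_of_mem (rels := triangleRels 2 p₂ p₃) (x := FreeGroup.of 2 ^ p₃)
      (by simp [triangleRels])
  have habc : a * b * c = 1 :=
    PresentedGroup.one_of_mem (rels := triangleRels 2 p₂ p₃)
      (x := FreeGroup.of 0 * FreeGroup.of 1 * FreeGroup.of 2) (by simp [triangleRels])
  have hab : (a * b) ^ p₃ = 1 := by
    rw [eq_inv_of_mul_eq_one_left habc, inv_pow, hc, inv_one]
  set H := Subgroup.closure {b ^ ν, a * b ^ ν' * a⁻¹}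
  have hbH : b ∈ H :=
    mem_of_zpow_mem_of_gcd_eq_one hb hν (Subgroup.subset_closure (by simp))
  have hconjH : a * b * a⁻¹ ∈ H := by
    refine mem_of_zpow_mem_of_gcd_eq_one (m := p₂) (by simp [conj_pow, hb]) hν' ?_
    rw [conj_zpow]
    exact Subgroup.subset_closure (by simp)
  have haH : a ∈ H := mem_of_conj_mem_of_odd ha hab hodd hbH hconjH
  have hcH : c ∈ H := by
    rw [eq_inv_of_mul_eq_one_right habc]
    exact H.inv_mem (H.mul_mem haH hbH)
  rw [eq_top_iff, ← PresentedGroup.closure_range_of, Subgroup.closure_le]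
  rintro _ ⟨i, rfl⟩
  fin_cases i
  exacts [haH, hbH, hcH]
end

section
/- Let p₃ ≥ 3 be odd and let ν be an integer with gcd(ν, p₃) = 1. Then the pair (s₁, s₂⁻¹s₃^νs₂) is a generating pair of the triangle group Δ(2, 3, p₃). -/
theorem Subgroup.mem_of_zpow_mem_of_pow_eq_one {G : Type*} [Group G] (H : Subgroup G) {x : G}
    {n : ℤ} {p : ℕ} (hn : x ^ n ∈ H) (hp : x ^ p = 1) (h : Int.gcd n p = 1) : x ∈ H := by
  have key : x = (x ^ n) ^ Int.gcdA n p := by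
    have bezout := Int.gcd_eq_gcd_ab n p
    rw [h] at bezout
    calc x = x ^ ((1 : ℕ) : ℤ) := by simp
      _ = (x ^ n) ^ Int.gcdA n p := by
        rw [bezout, zpow_add, zpow_mul, zpow_mul, zpow_natCast x p, hp, one_zpow, mul_one]
  rw [key]
  exact H.zpow_mem hn _

/-- In a quotient of `Δ(2, 3, p)` with `p` odd, a subgroup containing `a` and `b⁻¹ c ^ ν b`
contains `c`, because `a (b⁻¹ c b) = c ^ (-2)`. -/
theorem Subgroup.mem_of_triangle_relations {G : Type*} [Group G] (H : Subgroup G) {a b c : G}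
    {p : ℕ} {ν : ℤ} (ha : a ^ 2 = 1) (hb : b ^ 3 = 1) (hc : c ^ p = 1) (habc : a * b * c = 1)
    (hodd : Odd p) (hν : Int.gcd ν p = 1) (haH : a ∈ H) (hH : b⁻¹ * c ^ ν * b ∈ H) : c ∈ H := by
  have conj_zpow (n : ℤ) : (b⁻¹ * c * b) ^ n = b⁻¹ * c ^ n * b := by
    simpa using _root_.conj_zpow (i := n) (a := b⁻¹) (b := c)
  have hd : b⁻¹ * c * b ∈ H := by
    refine H.mem_of_zpow_mem_of_pow_eq_one (n := ν) (p := p) ?_ ?_ hν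
    · rwa [conj_zpow]
    · rw [← zpow_natCast, conj_zpow, zpow_natCast, hc]
      simp
  have hc_inv : c⁻¹ = a * b := (eq_inv_of_mul_eq_one_left habc).symm
  have ha_inv : a⁻¹ = a := inv_eq_of_mul_eq_one_right (by rw [← pow_two, ha])
  have hb_inv : b⁻¹ * b⁻¹ = b := by
    rw [← mul_inv_rev]
    exact inv_eq_of_mul_eq_one_right (by rw [← hb, pow_three'])
  have hprod : a * (b⁻¹ * c * b) = c ^ (-2 : ℤ) := by
    have hc_eq : c = b⁻¹ * a := by rw [← inv_inv c, hc_inv, mul_inv_rev, ha_inv]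
    calc a * (b⁻¹ * c * b) = a * (b⁻¹ * b⁻¹ * a * b) := by rw [hc_eq]; group
      _ = (a * b) * (a * b) := by rw [hb_inv]; group
      _ = c ^ (-2 : ℤ) := by rw [← hc_inv]; group
  refine H.mem_of_zpow_mem_of_pow_eq_one (hprod ▸ H.mul_mem haH hd) hc ?_
  simpa [Int.gcd] using hodd

theorem stmt_4 (p₃ : ℕ) (hp₃ : 3 ≤ p₃) (hodd : Odd p₃)
    (ν : ℤ) (hν : Int.gcd ν p₃ = 1)
    (S : Fin 3 → Triangle 2 3 p₃) (hS : S = triS 2 3 p₃) :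
    Subgroup.closure {S 0, (S 1)⁻¹ * S 2 ^ ν * S 1} =
      (⊤ : Subgroup (Triangle 2 3 p₃)) := by
  subst hS
  have hrel {r : FreeGroup (Fin 3)} (hr : r ∈ triangleRels 2 3 p₃) :
      PresentedGroup.mk (triangleRels 2 3 p₃) r = 1 :=
    PresentedGroup.one_of_mem hr
  have ha : triS 2 3 p₃ 0 ^ 2 = 1 := hrel (by simp [triangleRels])
  have hb : triS 2 3 p₃ 1 ^ 3 = 1 := hrel (by simp [triangleRels])
  have hc : triS 2 3 p₃ 2 ^ p₃ = 1 := hrel (by simp [triangleRels])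
  have habc : triS 2 3 p₃ 0 * triS 2 3 p₃ 1 * triS 2 3 p₃ 2 = 1 :=
    hrel (by simp [triangleRels])
  set H := Subgroup.closure
    {triS 2 3 p₃ 0, (triS 2 3 p₃ 1)⁻¹ * triS 2 3 p₃ 2 ^ ν * triS 2 3 p₃ 1}
  have h0 : triS 2 3 p₃ 0 ∈ H := Subgroup.subset_closure (by simp)
  have h2 : triS 2 3 p₃ 2 ∈ H :=
    H.mem_of_triangle_relations ha hb hc habc hodd hν h0 (Subgroup.subset_closure (by simp))
  have h1 : triS 2 3 p₃ 1 ∈ H := by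
    rw [← H.mul_mem_cancel_left h0, ← H.mul_mem_cancel_right h2, habc]
    exact H.one_mem
  rw [eq_top_iff, ← PresentedGroup.closure_range_of, Subgroup.closure_le]
  rintro _ ⟨i, rfl⟩
  fin_cases i
  exacts [h0, h1, h2]
end

section
/- Let ν be an integer with gcd(ν, 7) = 1. Then the pair (s₂, s₃⁻³s₁·s₃^ν·s₁s₃³) is a generating pair of the triangle group Δ(2, 3, 7). -/
/-- In a quotient of the `(2, 3, 7)` triangle group, generated by an involution `x` and an element
`y` of order three, the involution is a word in `y` and a conjugate of `(x * y)⁻¹`. -/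
theorem involution_eq_word {G : Type*} [Group G] {x y u : G} (hx : x ^ 2 = 1) (hy : y ^ 3 = 1)
    (hxy : (x * y) ^ 7 = 1) (hu : u = y⁻¹ * x * y⁻¹ * x * y * x * y⁻¹ * x) :
    u * y⁻¹ * u * y * u * y * u * y * u⁻¹ * u⁻¹ * y⁻¹ = x := by
  have hxx : x * x = 1 := by rw [← sq, hx]
  have hxi : x⁻¹ = x := inv_eq_of_mul_eq_one_left hxx
  have hyy : y * y = y⁻¹ := eq_inv_of_mul_eq_one_left (by rw [← pow_three', hy])
  have hYY : y⁻¹ * y⁻¹ = y := by rw [← mul_inv_rev, hyy, inv_inv]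
  have hxx' (t : G) : x * (x * t) = t := by rw [← mul_assoc, hxx, one_mul]
  have hYY' (t : G) : y⁻¹ * (y⁻¹ * t) = y * t := by rw [← mul_assoc, hYY]
  have hrel : y * x * y * x * y * x * y = x * y⁻¹ * x * y⁻¹ * x * y⁻¹ * x := by
    have h : x * (y * x * y * x * y * x * y) * (x * y * x * y * x * y) = 1 := by
      rw [← hxy]; simp only [pow_succ, pow_zero, one_mul, mul_assoc]
    have h' := eq_inv_of_mul_eq_one_left h
    rw [← mul_right_inj x, h']
    simp only [mul_inv_rev, hxi, mul_assoc, hxx']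
  have hrel' (t : G) : y * (x * (y * (x * (y * (x * (y * t)))))) =
      x * (y⁻¹ * (x * (y⁻¹ * (x * (y⁻¹ * (x * t)))))) := by
    simpa only [mul_assoc] using congrArg (· * t) hrel
  subst hu
  simp only [mul_inv_rev, inv_inv, hxi, mul_assoc, mul_inv_cancel_left, inv_mul_cancel_left,
    mul_inv_cancel, mul_one, hxx', hYY', hrel']

/-- An integer power prime to the exponent of `u` generates the same cyclic subgroup. -/
theorem mem_of_zpow_mem {G : Type*} [Group G] {H : Subgroup G} {u : G} {n : ℕ} {k : ℤ}
    (hn : u ^ n = 1) (hk : Int.gcd k n = 1) (h : u ^ k ∈ H) : u ∈ H := by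
  have hb := Int.gcd_eq_gcd_ab k n
  have : u = (u ^ k) ^ (Int.gcdA k n) := by
    conv_lhs => rw [← zpow_one u, show (1 : ℤ) = Int.gcd k n by rw [hk]; rfl, hb]
    rw [zpow_add, zpow_mul, zpow_mul, zpow_natCast, hn, one_zpow, mul_one]
  rw [this]
  exact H.zpow_mem h _

theorem triangle_relations (p₁ p₂ p₃ : ℕ) :
    triS p₁ p₂ p₃ 0 ^ p₁ = 1 ∧ triS p₁ p₂ p₃ 1 ^ p₂ = 1 ∧ triS p₁ p₂ p₃ 2 ^ p₃ = 1 ∧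
      triS p₁ p₂ p₃ 0 * triS p₁ p₂ p₃ 1 * triS p₁ p₂ p₃ 2 = 1 := by
  have h {r : FreeGroup (Fin 3)} (hr : r ∈ triangleRels p₁ p₂ p₃) :
      PresentedGroup.mk (triangleRels p₁ p₂ p₃) r = 1 :=
    PresentedGroup.one_of_mem hr
  exact ⟨h (by simp [triangleRels]), h (by simp [triangleRels]), h (by simp [triangleRels]),
    h (by simp [triangleRels])⟩

theorem stmt_7 (ν : ℤ) (hν : Int.gcd ν 7 = 1)
    (S : Fin 3 → Triangle 2 3 7) (hS : S = triS 2 3 7) :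
    Subgroup.closure {S 1, (S 2 ^ 3)⁻¹ * S 0 * S 2 ^ ν * (S 0 * S 2 ^ 3)} =
      (⊤ : Subgroup (Triangle 2 3 7)) := by
  obtain ⟨h₀, h₁, h₂, h₃⟩ := triangle_relations 2 3 7
  rw [← hS] at h₀ h₁ h₂ h₃
  have hz : S 2 = (S 0 * S 1)⁻¹ := eq_inv_of_mul_eq_one_right h₃
  have hxx : S 0 * S 0 = 1 := by rw [← sq, h₀]
  have hxi : (S 0)⁻¹ = S 0 := inv_eq_of_mul_eq_one_left hxx
  have hxy : (S 0 * S 1) ^ 7 = 1 := by rw [← inv_inv (S 0 * S 1), ← hz, inv_pow, h₂, inv_one]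
  have hyy : S 1 * S 1 = (S 1)⁻¹ := eq_inv_of_mul_eq_one_left (by rw [← pow_three', h₁])
  have hYY (t : Triangle 2 3 7) : (S 1)⁻¹ * ((S 1)⁻¹ * t) = S 1 * t := by
    rw [← mul_assoc, ← mul_inv_rev, hyy, inv_inv]
  have hxx' (t : Triangle 2 3 7) : S 0 * (S 0 * t) = t := by rw [← mul_assoc, hxx, one_mul]
  set H := Subgroup.closure {S 1, (S 2 ^ 3)⁻¹ * S 0 * S 2 ^ ν * (S 0 * S 2 ^ 3)}
  set w := (S 2 ^ 3)⁻¹ * S 0 with hw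
  have hwi : w⁻¹ = S 0 * S 2 ^ 3 := by rw [hw, mul_inv_rev, inv_inv, hxi]
  have hy : S 1 ∈ H := Subgroup.subset_closure (by simp)
  have hu : w * S 2 * w⁻¹ ∈ H := by
    refine mem_of_zpow_mem (n := 7) (k := ν) ?_ hν ?_
    · rw [conj_pow, h₂, mul_one, mul_inv_cancel]
    · rw [conj_zpow, hwi]
      exact Subgroup.subset_closure (Set.mem_insert_of_mem _ rfl)
  have huw : w * S 2 * w⁻¹ =
      (S 1)⁻¹ * S 0 * (S 1)⁻¹ * S 0 * S 1 * S 0 * (S 1)⁻¹ * S 0 := by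
    have hinv : (S 2 ^ 3)⁻¹ = S 2 ^ 4 := inv_eq_of_mul_eq_one_right (by rw [← pow_add, h₂])
    have hw' : w = S 2 ^ 4 * S 0 := by rw [hw, hinv]
    rw [hwi, hw', hz]
    simp only [pow_succ, pow_zero, one_mul, mul_inv_rev, hxi, mul_assoc, hxx', hYY,
      mul_inv_cancel_left]
  have hx : S 0 ∈ H := by
    rw [← involution_eq_word h₀ h₁ hxy huw]
    have hu' := H.inv_mem hu
    have hy' := H.inv_mem hy
    repeat' first | assumption | apply H.mul_mem
  have hz' : S 2 ∈ H := hz ▸ H.inv_mem (H.mul_mem hx hy)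
  rw [eq_top_iff, ← PresentedGroup.closure_range_of (triangleRels 2 3 7), Subgroup.closure_le]
  rintro _ ⟨i, rfl⟩
  change triS 2 3 7 i ∈ H
  rw [← hS]
  fin_cases i
  exacts [hx, hy, hz']
end

section
/- The pair ((s₁s₂²s₁s₂)²s₂s₁s₂, (s₂(s₂s₁)²)²s₂s₁) is a generating pair of the triangle group Δ(2, 3, 7). -/
/-- In a group generated by `a`, `b` with `a² = b³ = (ab)⁷ = 1`, a subgroup containing
`(ab²ab)²bab` and `(b(ba)²)²ba` contains `a` and `b`. -/
theorem mem_of_triangle_two_three_seven {G : Type*} [Group G] {a b : G} (ha : a ^ 2 = 1)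
    (hb : b ^ 3 = 1) (hab : (a * b) ^ 7 = 1) {H : Subgroup G}
    (hx : (a * b ^ 2 * a * b) ^ 2 * (b * a * b) ∈ H)
    (hy : (b * (b * a) ^ 2) ^ 2 * (b * a) ∈ H) : a ∈ H ∧ b ∈ H := by
  have aa : a * a = 1 := by rw [← pow_two, ha]
  have aaz (z : G) : a * (a * z) = z := by rw [← mul_assoc, aa, one_mul]
  have a_inv : a⁻¹ = a := inv_eq_of_mul_eq_one_left aa
  have bb : b * b = b⁻¹ := eq_inv_of_mul_eq_one_left (by rw [← hb, pow_three'])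
  have bbz (z : G) : b * (b * z) = b⁻¹ * z := by rw [← mul_assoc, bb]
  have BB : b⁻¹ * b⁻¹ = b := by rw [← mul_inv_rev, bb, inv_inv]
  have BBz (z : G) : b⁻¹ * (b⁻¹ * z) = b * z := by rw [← mul_assoc, BB]
  have inv_ab : (a * b)⁻¹ = b⁻¹ * a := by rw [mul_inv_rev, a_inv]
  have ab4 : (a * b) ^ 4 = (b⁻¹ * a) ^ 3 := by
    rw [← inv_ab, inv_pow, eq_inv_iff_mul_eq_one, ← pow_add, hab]
  have Ba4 : (b⁻¹ * a) ^ 4 = (a * b) ^ 3 := by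
    rw [← inv_ab, inv_pow, inv_eq_iff_mul_eq_one, ← pow_add, hab]
  set x := (a * b ^ 2 * a * b) ^ 2 * (b * a * b) with hx_def
  set y := (b * (b * a) ^ 2) ^ 2 * (b * a) with hy_def
  have hxw : x = a * b⁻¹ * (a * b) * (a * b⁻¹ * a * b⁻¹) * (a * b) := by
    simp only [hx_def, pow_two, mul_assoc, bbz, bb]
  have hxy : x * y = a * b * (a * b⁻¹ * a * b⁻¹) := calc
    x * y = a * b⁻¹ * (a * b) ^ 4 * a := by
      simp only [hxw, hy_def, pow_succ, pow_zero, one_mul, mul_assoc, bbz, BBz, aaz,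
        mul_inv_cancel_left, inv_mul_cancel_left]
    _ = _ := by
      rw [ab4]
      simp only [pow_succ, pow_zero, one_mul, mul_one, mul_assoc, BBz, aa]
  have hyx : y * x = (b⁻¹ * a) ^ 2 * (b * a * b⁻¹) := calc
    y * x = b⁻¹ * a * b * a * (b⁻¹ * a) ^ 4 * b := by
      simp only [hxw, hy_def, pow_succ, pow_zero, one_mul, mul_assoc, bbz, aaz,
        mul_inv_cancel_left]
    _ = _ := by
      rw [Ba4]
      simp only [pow_succ, pow_zero, one_mul, mul_assoc, bb, bbz, aaz]
  have hcomm : x * y * (y * x)⁻¹ = (b⁻¹ * a) ^ 3 := by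
    have h5 : (b⁻¹ * a) ^ 5 = (a * b) ^ 2 := by
      rw [← inv_ab, inv_pow, inv_eq_iff_mul_eq_one, ← pow_add, hab]
    rw [mul_inv_eq_iff_eq_mul, hxy, hyx, ← mul_assoc ((b⁻¹ * a) ^ 3), ← pow_add, h5]
    simp only [pow_two, mul_assoc, bbz]
  have h_ab : a * b ∈ H := by
    have h6 : a * b = ((b⁻¹ * a) ^ 3) ^ 2 := by
      rw [← inv_ab, ← pow_mul, inv_pow, eq_inv_iff_mul_eq_one, ← pow_succ', hab]
    rw [h6, ← hcomm]
    exact H.pow_mem (H.mul_mem (H.mul_mem hx hy) (H.inv_mem (H.mul_mem hy hx))) 2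
  have h_aBaB : a * b⁻¹ * a * b⁻¹ ∈ H :=
    (H.mul_mem_cancel_left h_ab).1 (hxy ▸ H.mul_mem hx hy)
  have h_aB : a * b⁻¹ ∈ H := by
    rw [hxw] at hx
    exact (H.mul_mem_cancel_right h_ab).1 ((H.mul_mem_cancel_right h_aBaB).1
      ((H.mul_mem_cancel_right h_ab).1 hx))
  have h_b : b ∈ H := by
    have h := H.mul_mem (H.inv_mem h_ab) h_aB
    rwa [inv_ab, mul_assoc, aaz, BB] at h
  exact ⟨(H.mul_mem_cancel_right h_b).1 h_ab, h_b⟩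

theorem stmt_8 (S : Fin 3 → Triangle 2 3 7) (hS : S = triS 2 3 7) :
    Subgroup.closure {(S 0 * S 1 ^ 2 * S 0 * S 1) ^ 2 * (S 1 * S 0 * S 1),
        (S 1 * (S 1 * S 0) ^ 2) ^ 2 * (S 1 * S 0)} =
      (⊤ : Subgroup (Triangle 2 3 7)) := by
  have h0 : S 0 ^ 2 = 1 := by
    subst hS
    exact PresentedGroup.one_of_mem (rels := triangleRels 2 3 7) (by simp [triangleRels])
  have h1 : S 1 ^ 3 = 1 := by
    subst hS
    exact PresentedGroup.one_of_mem (rels := triangleRels 2 3 7) (by simp [triangleRels])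
  have h2 : S 2 ^ 7 = 1 := by
    subst hS
    exact PresentedGroup.one_of_mem (rels := triangleRels 2 3 7) (by simp [triangleRels])
  have h012 : S 0 * S 1 * S 2 = 1 := by
    subst hS
    exact PresentedGroup.one_of_mem (rels := triangleRels 2 3 7) (by simp [triangleRels])
  have h01 : (S 0 * S 1) ^ 7 = 1 := by
    rw [eq_inv_of_mul_eq_one_left h012, inv_pow, h2, inv_one]
  obtain ⟨m0, m1⟩ := mem_of_triangle_two_three_seven h0 h1 h01
    (Subgroup.subset_closure (Set.mem_insert _ _))
    (Subgroup.subset_closure (Set.mem_insert_of_mem _ (Set.mem_singleton _)))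
  have m2 : S 2 ∈ Subgroup.closure {(S 0 * S 1 ^ 2 * S 0 * S 1) ^ 2 * (S 1 * S 0 * S 1),
      (S 1 * (S 1 * S 0) ^ 2) ^ 2 * (S 1 * S 0)} := by
    rw [eq_inv_of_mul_eq_one_right h012]
    exact inv_mem (mul_mem m0 m1)
  rw [eq_top_iff, ← PresentedGroup.closure_range_of, Subgroup.closure_le]
  rintro _ ⟨i, rfl⟩
  have hi : PresentedGroup.of i = S i := by rw [hS]; rfl
  rw [hi]
  fin_cases i
  exacts [m0, m1, m2]
end

section
/- Let p₃ ≥ 4 with gcd(p₃, 3) = 1. Then the pair (s₁s₂², s₂²s₁) is a generating pair of the triangle group Δ(3, 3, p₃). -/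
/-- If `a ^ 3 = b ^ 3 = (a * b) ^ p = 1` with `p` coprime to `3`, then any subgroup containing
`a * b ^ 2` and `b ^ 2 * a` contains `b`. -/
theorem mem_of_mul_sq_mem_of_sq_mul_mem {G : Type*} [Group G] {a b : G} {p : ℕ} (ha : a ^ 3 = 1)
    (hb : b ^ 3 = 1) (hab : (a * b) ^ p = 1) (hp : Nat.gcd p 3 = 1) {H : Subgroup G}
    (hx : a * b ^ 2 ∈ H) (hy : b ^ 2 * a ∈ H) : b ∈ H := by
  have hb2 : b ^ 2 = b⁻¹ := by rw [eq_inv_iff_mul_eq_one, ← pow_succ, hb]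
  have ha2 : a * a = a⁻¹ := by rw [eq_inv_iff_mul_eq_one, ← pow_two, ← pow_succ, ha]
  rw [hb2] at hx hy
  have hconj : ∀ n : ℕ, (b ^ n)⁻¹ * (a * b⁻¹) * b ^ n ∈ H ∧
      (b ^ n)⁻¹ * (b⁻¹ * a) * b ^ n ∈ H := by
    intro n
    induction n with
    | zero => simpa using ⟨hx, hy⟩
    | succ n ih =>
      refine ⟨?_, ?_⟩
      · convert ih.2 using 1
        rw [pow_succ']
        group
      · convert H.mul_mem (H.inv_mem ih.1) (H.inv_mem ih.2) using 1
        have key : b⁻¹ * (b⁻¹ * a) * b = (a * b⁻¹)⁻¹ * (b⁻¹ * a)⁻¹ := by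
          calc b⁻¹ * (b⁻¹ * a) * b = (b ^ 2)⁻¹ * a * b := by group
            _ = b * (a * a)⁻¹ * b := by rw [hb2, ha2, inv_inv, inv_inv]
            _ = _ := by group
        calc (b ^ (n + 1))⁻¹ * (b⁻¹ * a) * b ^ (n + 1)
            = (b ^ n)⁻¹ * (b⁻¹ * (b⁻¹ * a) * b) * b ^ n := by rw [pow_succ']; group
          _ = _ := by rw [key]; group
  have hpow : ∀ n : ℕ, (a * b) ^ n * b ^ n ∈ H := by
    intro n
    induction n with
    | zero => simp
    | succ n ih =>
      convert H.mul_mem ih (hconj n).1 using 1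
      rw [← hb2, pow_succ, pow_succ']
      group
  have hbp : b ^ p ∈ H := by simpa [hab] using hpow p
  have hbez : b ^ ((Nat.gcd p 3 : ℕ) : ℤ) ∈ H := by
    rw [Nat.gcd_eq_gcd_ab, zpow_add, zpow_mul, zpow_mul, zpow_natCast, zpow_natCast, hb, one_zpow,
      mul_one]
    exact H.zpow_mem hbp _
  simpa [hp] using hbez

theorem stmt_9 (p₃ : ℕ) (hp₃ : 4 ≤ p₃) (hgcd : Nat.gcd p₃ 3 = 1)
    (S : Fin 3 → Triangle 3 3 p₃) (hS : S = triS 3 3 p₃) :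
    Subgroup.closure {S 0 * S 1 ^ 2, S 1 ^ 2 * S 0} =
      (⊤ : Subgroup (Triangle 3 3 p₃)) := by
  subst hS
  set H := Subgroup.closure {triS 3 3 p₃ 0 * triS 3 3 p₃ 1 ^ 2, triS 3 3 p₃ 1 ^ 2 * triS 3 3 p₃ 0}
  have rel : ∀ r ∈ triangleRels 3 3 p₃, PresentedGroup.mk (triangleRels 3 3 p₃) r = 1 :=
    fun r hr => PresentedGroup.one_of_mem hr
  have h0 : triS 3 3 p₃ 0 ^ 3 = 1 := rel (FreeGroup.of 0 ^ 3) (by simp [triangleRels])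
  have h1 : triS 3 3 p₃ 1 ^ 3 = 1 := rel (FreeGroup.of 1 ^ 3) (by simp [triangleRels])
  have h2 : triS 3 3 p₃ 2 ^ p₃ = 1 := rel (FreeGroup.of 2 ^ p₃) (by simp [triangleRels])
  have h012 : triS 3 3 p₃ 0 * triS 3 3 p₃ 1 * triS 3 3 p₃ 2 = 1 :=
    rel (FreeGroup.of 0 * FreeGroup.of 1 * FreeGroup.of 2) (by simp [triangleRels])
  have h01 : (triS 3 3 p₃ 0 * triS 3 3 p₃ 1) ^ p₃ = 1 := by
    rw [eq_inv_of_mul_eq_one_left h012, inv_pow, h2, inv_one]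
  have hx : triS 3 3 p₃ 0 * triS 3 3 p₃ 1 ^ 2 ∈ H := Subgroup.subset_closure (by simp)
  have hy : triS 3 3 p₃ 1 ^ 2 * triS 3 3 p₃ 0 ∈ H := Subgroup.subset_closure (by simp)
  have hb : triS 3 3 p₃ 1 ∈ H := mem_of_mul_sq_mem_of_sq_mul_mem h0 h1 h01 hgcd hx hy
  have ha : triS 3 3 p₃ 0 ∈ H := (H.mul_mem_cancel_right (H.pow_mem hb 2)).1 hx
  have hc : triS 3 3 p₃ 2 ∈ H := by
    rw [eq_inv_of_mul_eq_one_right h012]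
    exact H.inv_mem (H.mul_mem ha hb)
  rw [eq_top_iff, ← PresentedGroup.closure_range_of, Subgroup.closure_le]
  rintro _ ⟨i, rfl⟩
  fin_cases i
  exacts [ha, hb, hc]
end

section
/- Let p₃ ≥ 7 be odd. Then the pair (s₁s₂², s₂³s₁s₂³) is a generating pair of the triangle group Δ(2, 4, p₃). -/
/-- If `a ^ 2 = b ^ 4 = (a * b) ^ n = 1` with `n` odd, then a subgroup containing `a * b ^ 2` and
`b ^ 3 * a * b ^ 3` contains `a` and `b`: the commutator of these two elements is `(a * b) ^ 4`. -/
theorem Subgroup.mem_and_mem_of_sq_eq_one_of_pow_four_eq_one {G : Type*} [Group G] {a b : G}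
    {n : ℕ} (hn : Odd n) (ha : a ^ 2 = 1) (hb : b ^ 4 = 1) (hab : (a * b) ^ n = 1)
    {H : Subgroup G} (hu : a * b ^ 2 ∈ H) (hv : b ^ 3 * a * b ^ 3 ∈ H) : a ∈ H ∧ b ∈ H := by
  have ha' : a⁻¹ = a := inv_eq_of_mul_eq_one_left (by rw [← sq, ha])
  have hb3 : b ^ 3 = b⁻¹ := eq_inv_of_mul_eq_one_left (by rw [← pow_succ, hb])
  have hb3' : b⁻¹ * b⁻¹ * b⁻¹ = b := by
    rw [← hb3, ← pow_add, ← pow_add, show 3 + 3 + 3 = 4 + 4 + 1 from rfl, pow_add, pow_add, hb]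
    simp
  have hcomm : a * b ^ 2 * (b ^ 3 * a * b ^ 3) * (a * b ^ 2)⁻¹ * (b ^ 3 * a * b ^ 3)⁻¹ =
      (a * b) ^ 4 := by
    calc _ = a * b * a * (b⁻¹ * b⁻¹ * b⁻¹) * a⁻¹ * b * a⁻¹ * b := by rw [hb3]; group
      _ = (a * b) ^ 4 := by rw [hb3', ha']; simp only [pow_succ, pow_zero, one_mul, mul_assoc]
  have hc4 : (a * b) ^ 4 ∈ H :=
    hcomm ▸ H.mul_mem (H.mul_mem (H.mul_mem hu hv) (H.inv_mem hu)) (H.inv_mem hv)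
  have hcop : Nat.Coprime (orderOf (a * b)) 4 :=
    Nat.Coprime.coprime_dvd_left (orderOf_dvd_of_pow_eq_one hab)
      (Nat.Coprime.pow_right 2 (Nat.coprime_two_right.mpr hn))
  obtain ⟨m, hm⟩ := exists_pow_eq_self_of_coprime hcop.symm
  have hc : a * b ∈ H := hm ▸ H.pow_mem hc4 m
  have hbH : b ∈ H := by
    have h := H.mul_mem (H.inv_mem hc) hu
    rwa [sq, ← mul_assoc a, inv_mul_cancel_left] at h
  exact ⟨(H.mul_mem_cancel_right hbH).mp hc, hbH⟩

theorem stmt_10 (p₃ : ℕ) (hp₃ : 7 ≤ p₃) (hodd : Odd p₃)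
    (S : Fin 3 → Triangle 2 4 p₃) (hS : S = triS 2 4 p₃) :
    Subgroup.closure {S 0 * S 1 ^ 2, S 1 ^ 3 * S 0 * S 1 ^ 3} =
      (⊤ : Subgroup (Triangle 2 4 p₃)) := by
  have hrel : ∀ r ∈ triangleRels 2 4 p₃, PresentedGroup.mk (triangleRels 2 4 p₃) r = 1 :=
    fun r hr => PresentedGroup.one_of_mem hr
  simp only [triangleRels, Set.mem_insert_iff, Set.mem_singleton_iff, forall_eq_or_imp,
    forall_eq] at hrel
  obtain ⟨h0, h1, h2, h012⟩ : S 0 ^ 2 = 1 ∧ S 1 ^ 4 = 1 ∧ S 2 ^ p₃ = 1 ∧ S 0 * S 1 * S 2 = 1 := by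
    subst hS; exact hrel
  have h01 : (S 0 * S 1) ^ p₃ = 1 := by
    rw [eq_inv_of_mul_eq_one_left h012, inv_pow, h2, inv_one]
  set H := Subgroup.closure {S 0 * S 1 ^ 2, S 1 ^ 3 * S 0 * S 1 ^ 3}
  obtain ⟨hm0, hm1⟩ := Subgroup.mem_and_mem_of_sq_eq_one_of_pow_four_eq_one (H := H) hodd h0 h1 h01
    (Subgroup.subset_closure (by simp)) (Subgroup.subset_closure (by simp))
  have hm2 : S 2 ∈ H := by
    rw [eq_inv_of_mul_eq_one_right h012]
    exact H.inv_mem (H.mul_mem hm0 hm1)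
  rw [eq_top_iff, ← PresentedGroup.closure_range_of, Subgroup.closure_le]
  rintro _ ⟨i, rfl⟩
  change triS 2 4 p₃ i ∈ H
  rw [← hS]
  fin_cases i
  exacts [hm0, hm1, hm2]
end

section
/- In the triangle group Δ(2, 3, 5), the pair (s₂s₁s₂⁻¹, ((s₁s₂)²s₁)·s₃·((s₁s₂)²s₁)⁻¹) is Nielsen equivalent to the standard pair (s₁, s₃²). -/
namespace NielsenEquiv

variable {G : Type*} [Group G]

theorem trans {p q r : G × G} (h₁ : NielsenEquiv p q) (h₂ : NielsenEquiv q r) :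
    NielsenEquiv p r :=
  Relation.EqvGen.trans _ _ _ h₁ h₂

theorem of_step {p q : G × G} (h : NielsenStep p q) : NielsenEquiv p q :=
  Relation.EqvGen.rel _ _ h

theorem mul_right_fst (g h : G) : NielsenEquiv (g, h) (g * h, h) :=
  of_step (.mul₁ g h)

theorem mul_right_snd (g h : G) : NielsenEquiv (g, h) (g, h * g) :=
  of_step (.mul₂ g h)

theorem inv_mul_left_fst (g h : G) : NielsenEquiv (g, h) (h⁻¹ * g, h) := by
  have key := ((of_step (.inv₁ g h)).trans (mul_right_fst g⁻¹ h)).trans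
    (of_step (.inv₁ (g⁻¹ * h) h))
  simpa using key

theorem mul_left_fst (g h : G) : NielsenEquiv (g, h) (h * g, h) := by
  have key := ((of_step (.inv₂ g h)).trans (inv_mul_left_fst g h⁻¹)).trans
    (of_step (.inv₂ (h⁻¹⁻¹ * g) h⁻¹))
  simpa using key

theorem mul_left_snd (g h : G) : NielsenEquiv (g, h) (g, g * h) :=
  ((of_step (.swap g h)).trans (mul_left_fst h g)).trans (of_step (.swap (g * h) g))

/-- The Nielsen equivalence in any group whose elements `a`, `b`, `c` satisfy the relations of
the triangle group `Δ(2, 3, 5)`. -/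
theorem of_triangle_two_three_five {a b c : G} (ha : a ^ 2 = 1) (hb : b ^ 3 = 1)
    (hc : c ^ 5 = 1) (habc : a * b * c = 1) :
    NielsenEquiv (b * a * b⁻¹, ((a * b) ^ 2 * a) * c * ((a * b) ^ 2 * a)⁻¹) (a, c ^ 2) := by
  have ainv : a⁻¹ = a := inv_eq_of_mul_eq_one_left (by rwa [← sq])
  have haa : a * a = 1 := by rwa [← sq]
  have hab : a * b = c⁻¹ := eq_inv_of_mul_eq_one_left habc
  have hb' : b = a * c⁻¹ := by rw [← hab, ← mul_assoc, haa, one_mul]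
  have c3 : c * c * c = c⁻¹ * c⁻¹ := by
    have : c * c * c * (c * c) = 1 := by rw [← hc]; simp [pow_succ, mul_assoc]
    rw [eq_inv_of_mul_eq_one_left this, mul_inv_rev]
  have haca : a * c * a = c⁻¹ * a * c⁻¹ := by
    have h : a * c⁻¹ * a * (c⁻¹ * a * c⁻¹) = 1 := by rw [← hb, hb']; simp [pow_succ, mul_assoc]
    rw [← inv_eq_of_mul_eq_one_right h]
    simp [ainv, mul_assoc]
  have hsnd : ((a * b) ^ 2 * a) * c * ((a * b) ^ 2 * a)⁻¹ = c * c * a * c := by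
    calc _ = c⁻¹ * c⁻¹ * (a * c * a) * c * c := by
            rw [hab, mul_inv_rev, ainv]; simp [pow_succ, mul_assoc]
      _ = c⁻¹ * c⁻¹ * c⁻¹ * a * c := by rw [haca]; simp [mul_assoc]
      _ = c * c * a * c := by rw [← c3]; simp [mul_assoc]
  have hfst : b * a * b⁻¹ * (c * c * a * c) = a * c * c * a := by
    calc _ = a * c⁻¹ * (a * c * a) * (c * c * a * c) := by
            rw [hb', mul_inv_rev, ainv]; simp [mul_assoc]
      _ = a * c⁻¹ * (c⁻¹ * a * c⁻¹) * (c * c * a * c) := by rw [haca]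
      _ = a * c⁻¹ * c⁻¹ * (a * c * a) * c := by simp [mul_assoc]
      _ = a * (c⁻¹ * c⁻¹) * c⁻¹ * a := by rw [haca]; simp [mul_assoc]
      _ = a * c * c * a := by rw [← c3]; simp [mul_assoc]
  have hmul : c * c * a * c * (a * c * c * a) = b := by
    calc _ = c * c * (a * c * a) * c * c * a := by simp [mul_assoc]
      _ = c * c * (c⁻¹ * a * c⁻¹) * c * c * a := by rw [haca]
      _ = c * (a * c * a) := by simp [mul_assoc]
      _ = b := by rw [haca, hb']; simp [mul_assoc]
  have hinv : b⁻¹ * (a * c * c * a) = c * c * c * a := by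
    calc _ = c * (a * a) * c * c * a := by rw [hb', mul_inv_rev, ainv]; simp [mul_assoc]
      _ = c * c * c * a := by rw [haa]; simp [mul_assoc]
  have hsq : c * c * c * a * b = c ^ 2 := by
    rw [mul_assoc, hab]; simp [pow_succ, mul_assoc]
  have hpow : c ^ 2 * (c * c * c * a) = a := by
    calc _ = c ^ 5 * a := by simp [pow_succ, mul_assoc]
      _ = a := by rw [hc, one_mul]
  rw [hsnd]
  have h₁ := mul_right_fst (b * a * b⁻¹) (c * c * a * c)
  rw [hfst] at h₁
  have h₂ := mul_right_snd (a * c * c * a) (c * c * a * c)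
  rw [hmul] at h₂
  have h₃ := inv_mul_left_fst (a * c * c * a) b
  rw [hinv] at h₃
  have h₄ := mul_left_snd (c * c * c * a) b
  rw [hsq] at h₄
  have h₅ := mul_left_fst (c * c * c * a) (c ^ 2)
  rw [hpow] at h₅
  exact (((h₁.trans h₂).trans h₃).trans h₄).trans h₅

end NielsenEquiv

theorem stmt_12 (S : Fin 3 → Triangle 2 3 5) (hS : S = triS 2 3 5) :
    NielsenEquiv
      (S 1 * S 0 * (S 1)⁻¹,
        ((S 0 * S 1) ^ 2 * S 0) * S 2 * ((S 0 * S 1) ^ 2 * S 0)⁻¹)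
      (S 0, S 2 ^ 2) := by
  subst hS
  have rel {r : FreeGroup (Fin 3)} (hr : r ∈ triangleRels 2 3 5) :
      PresentedGroup.mk (triangleRels 2 3 5) r = 1 :=
    PresentedGroup.one_of_mem hr
  refine NielsenEquiv.of_triangle_two_three_five
    (rel (r := FreeGroup.of 0 ^ 2) ?_) (rel (r := FreeGroup.of 1 ^ 3) ?_)
    (rel (r := FreeGroup.of 2 ^ 5) ?_)
    (rel (r := FreeGroup.of 0 * FreeGroup.of 1 * FreeGroup.of 2) ?_) <;>
  simp [triangleRels]
end

section
/- Let p₂ ≥ 2 and let G₀ = ℤ/2 ⋆ ℤ/p₂ with canonical generators a (of order 2) and b (of order p₂). Then the subgroup H of G₀ generated by {b, aba⁻¹} has index 2 in G₀, and the homomorphism ℤ/p₂ ⋆ ℤ/p₂ → G₀ sending the canonical generator of the first factor to b and the canonical generator of the second factor to aba⁻¹ is injective with range equal to H. -/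
/-- The free product ℤ/2 ⋆ ℤ/p₂. -/
abbrev G₀ (p₂ : ℕ) : Type :=
  Monoid.Coprod (Multiplicative (ZMod 2)) (Multiplicative (ZMod p₂))

/-- The canonical generator `a` of the first factor (of order 2). -/
def genA (p₂ : ℕ) : G₀ p₂ := Monoid.Coprod.inl (Multiplicative.ofAdd 1)

/-- The canonical generator `b` of the second factor (of order p₂). -/
def genB (p₂ : ℕ) : G₀ p₂ := Monoid.Coprod.inr (Multiplicative.ofAdd 1)

namespace Monoid.Coprod

variable (N : Type*) [Group N]

/-- The nontrivial element of the order-two factor of `ℤ/2 ∗ N`. -/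
def involution : Coprod (Multiplicative (ZMod 2)) N := inl (Multiplicative.ofAdd 1)

lemma involution_mul_self : involution N * involution N = 1 := by
  rw [involution, ← map_mul, show Multiplicative.ofAdd (1 : ZMod 2) * Multiplicative.ofAdd 1 = 1
    from rfl, map_one]

/-- The action of `ℤ/2` on `N ∗ N` exchanging the two factors. -/
def swapAction : Multiplicative (ZMod 2) →* MulAut (Coprod N N) where
  toFun z := if z = 1 then 1 else MulEquiv.coprodComm N N
  map_one' := if_pos rfl
  map_mul' := by
    have h : MulEquiv.coprodComm N N * MulEquiv.coprodComm N N = 1 :=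
      MulEquiv.ext fun x => swap_swap x
    have two : ∀ z : Multiplicative (ZMod 2), z = 1 ∨ z = Multiplicative.ofAdd 1 := by decide
    have ne : Multiplicative.ofAdd (1 : ZMod 2) ≠ 1 := by decide
    have sq : Multiplicative.ofAdd (1 : ZMod 2) * Multiplicative.ofAdd 1 = 1 := rfl
    intro x y
    rcases two x with rfl | rfl <;> rcases two y with rfl | rfl <;> simp only [one_mul, mul_one,
      sq, if_pos, if_neg ne, h]

lemma swapAction_generator (k : Coprod N N) :
    swapAction N (Multiplicative.ofAdd 1) k = swap N N k := rfl

/-- The homomorphism `N ∗ N → ℤ/2 ∗ N` which is the inclusion of `N` on the first factor and its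
conjugate by the involution on the second. -/
def doubleHom : Coprod N N →* Coprod (Multiplicative (ZMod 2)) N :=
  lift inr ((MulAut.conj (involution N)).toMonoidHom.comp inr)

@[simp] lemma doubleHom_inl (n : N) : doubleHom N (inl n) = inr n := lift_apply_inl ..

@[simp] lemma doubleHom_inr (n : N) :
    doubleHom N (inr n) = involution N * inr n * (involution N)⁻¹ := lift_apply_inr ..

lemma doubleHom_swap (k : Coprod N N) :
    doubleHom N (swap N N k) = involution N * doubleHom N k * (involution N)⁻¹ := by
  have h : (doubleHom N).comp (swap N N) =
      (MulAut.conj (involution N)).toMonoidHom.comp (doubleHom N) := by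
    have inv : (involution N)⁻¹ = involution N := inv_eq_of_mul_eq_one_left (involution_mul_self N)
    ext n
    · simp
    · simp [inv, mul_assoc, involution_mul_self]
      simp [← mul_assoc, involution_mul_self]
  exact DFunLike.congr_fun h k

/-- The homomorphism from `ℤ/2 ∗ N` to the semidirect product `(N ∗ N) ⋊ ℤ/2`. -/
def toSemidirect :
    Coprod (Multiplicative (ZMod 2)) N →* Coprod N N ⋊[swapAction N] Multiplicative (ZMod 2) :=
  lift SemidirectProduct.inr (SemidirectProduct.inl.comp inl)

/-- The homomorphism from the semidirect product `(N ∗ N) ⋊ ℤ/2` to `ℤ/2 ∗ N`. -/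
def ofSemidirect :
    Coprod N N ⋊[swapAction N] Multiplicative (ZMod 2) →* Coprod (Multiplicative (ZMod 2)) N :=
  SemidirectProduct.lift (doubleHom N) inl fun z => by
    have two : ∀ z : Multiplicative (ZMod 2), z = 1 ∨ z = Multiplicative.ofAdd 1 := by decide
    refine MonoidHom.ext fun k => ?_
    rcases two z with rfl | rfl
    · simp
    · exact doubleHom_swap N k

lemma ofSemidirect_toSemidirect (g : Coprod (Multiplicative (ZMod 2)) N) :
    ofSemidirect N (toSemidirect N g) = g := by
  have h : (ofSemidirect N).comp (toSemidirect N) = MonoidHom.id _ := by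
    apply hom_ext <;> refine MonoidHom.ext fun x => ?_ <;> simp [ofSemidirect, toSemidirect]
  exact DFunLike.congr_fun h g

lemma toSemidirect_doubleHom (k : Coprod N N) :
    toSemidirect N (doubleHom N k) = SemidirectProduct.inl k := by
  have h : (toSemidirect N).comp (doubleHom N) = SemidirectProduct.inl := by
    apply hom_ext <;> refine MonoidHom.ext fun x => ?_
    · simp [toSemidirect]
    · simp only [MonoidHom.comp_apply, doubleHom_inr, map_mul, map_inv]
      simp only [toSemidirect, involution, lift_apply_inl, lift_apply_inr, MonoidHom.comp_apply]
      rw [← map_inv, ← SemidirectProduct.inl_aut, swapAction_generator, swap_inl]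
  exact DFunLike.congr_fun h k

lemma doubleHom_injective : Function.Injective (doubleHom N) := fun x y h =>
  SemidirectProduct.inl_injective (φ := swapAction N) <| by
    rw [← toSemidirect_doubleHom, h, toSemidirect_doubleHom]

lemma range_doubleHom :
    (doubleHom N).range = (SemidirectProduct.rightHom.comp (toSemidirect N)).ker := by
  ext g
  constructor
  · rintro ⟨k, rfl⟩
    simp [MonoidHom.mem_ker, toSemidirect_doubleHom]
  · intro hg
    rw [MonoidHom.mem_ker, MonoidHom.comp_apply, ← MonoidHom.mem_ker,
      ← SemidirectProduct.range_inl_eq_ker_rightHom] at hg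
    obtain ⟨k, hk⟩ := hg
    refine ⟨k, ?_⟩
    rw [← ofSemidirect_toSemidirect N g, ← hk]
    simp [ofSemidirect]

lemma index_range_doubleHom : (doubleHom N).range.index = 2 := by
  have hs : Function.Surjective (SemidirectProduct.rightHom.comp (toSemidirect N)) := fun z =>
    ⟨inl z, by simp [toSemidirect]⟩
  rw [range_doubleHom, Subgroup.index_ker, MonoidHom.range_eq_top.mpr hs]
  simp

end Monoid.Coprod

lemma MonoidHom.range_eq_zpowers_ofAdd_one {G : Type*} [Group G] (n : ℕ)
    (f : Multiplicative (ZMod n) →* G) :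
    f.range = Subgroup.zpowers (f (Multiplicative.ofAdd 1)) := by
  have h : Subgroup.zpowers (Multiplicative.ofAdd (1 : ZMod n)) = ⊤ := by
    refine eq_top_iff.mpr fun x _ => ?_
    obtain ⟨k, hk⟩ := ZMod.intCast_surjective x.toAdd
    exact ⟨k, by simp [← ofAdd_zsmul, hk]⟩
  rw [MonoidHom.range_eq_map, ← h, MonoidHom.map_zpowers]

theorem stmt_15 (p₂ : ℕ) (hp₂ : 2 ≤ p₂)
    (a b : G₀ p₂) (ha : a = genA p₂) (hb : b = genB p₂)
    (H : Subgroup (G₀ p₂)) (hH : H = Subgroup.closure {b, a * b * a⁻¹}) :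
    H.index = 2 ∧
    ∃ φ : Monoid.Coprod (Multiplicative (ZMod p₂)) (Multiplicative (ZMod p₂)) →* G₀ p₂,
      φ (Monoid.Coprod.inl (Multiplicative.ofAdd 1)) = b ∧
      φ (Monoid.Coprod.inr (Multiplicative.ofAdd 1)) = a * b * a⁻¹ ∧
      Function.Injective φ ∧ φ.range = H := by
  have hl : Monoid.Coprod.doubleHom _ (Monoid.Coprod.inl (Multiplicative.ofAdd 1)) = b := by
    rw [hb, Monoid.Coprod.doubleHom_inl, genB]
  have hr : Monoid.Coprod.doubleHom _ (Monoid.Coprod.inr (Multiplicative.ofAdd 1)) =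
      a * b * a⁻¹ := by
    rw [ha, hb, Monoid.Coprod.doubleHom_inr, genA, genB, Monoid.Coprod.involution]
  have hrange : (Monoid.Coprod.doubleHom (Multiplicative (ZMod p₂))).range = H := by
    rw [Monoid.Coprod.range_eq, MonoidHom.range_eq_zpowers_ofAdd_one,
      MonoidHom.range_eq_zpowers_ofAdd_one, MonoidHom.comp_apply, MonoidHom.comp_apply, hl, hr, hH,
      Subgroup.zpowers_eq_closure, Subgroup.zpowers_eq_closure, ← Subgroup.closure_union,
      Set.singleton_union]
  exact ⟨hrange ▸ Monoid.Coprod.index_range_doubleHom _, _, hl, hr,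
    Monoid.Coprod.doubleHom_injective _, hrange⟩
end
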